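/- Let F : ℝ^n → ℝ be L-Lipschitz on a convex set A ⊂ ℝ^n, let X be a random vector in ℝ^n whose law restricted to A is strongly log-concave with parameter γ > 0, and suppose P(X ∈ A) is close to 1. Then conditional on {X ∈ A}, for all ε > 0: P(|F(X) − E[F(X)|X∈A]| > ε | X ∈ A) ≤ 2exp(−γε²/(cL²)) for an absolute constant c (one may take c = 4). Applied to the SNIS statistic with Lipschitz constant L = √(40/N₂)·Bβ/(Ew), this yields P(|SNIS deviation| > ε/3 | concentration event) ≤ 2exp(−γ N₂ (Ew)² ε² / (1440 B²β²)). -/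

import Mathlib

open MeasureTheory ProbabilityTheory

/-- One-dimensional Brunn–Minkowski inequality for midpoints of compact sets. -/
theorem volume_add_volume_le_of_isCompact {A B C : Set ℝ} (hA : IsCompact A) (hB : IsCompact B)
    (hA0 : A.Nonempty) (hB0 : B.Nonempty) (h : ∀ x ∈ A, ∀ y ∈ B, (x + y) / 2 ∈ C) :
    volume A + volume B ≤ 2 * volume C := by
  obtain ⟨a, haA, ha⟩ := hA.exists_isGreatest hA0
  obtain ⟨b, hbB, hb⟩ := hB.exists_isLeast hB0
  have hC : volume ((fun x : ℝ => (1 / 2) * x) ⁻¹' C) = 2 * volume C := by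
    rw [Real.volume_preimage_mul_left (by norm_num)]
    norm_num
  have h1 : volume ((fun x => -b + x) ⁻¹' A) = volume A := measure_preimage_add _ _ _
  have h2 : volume ((fun x => -a + x) ⁻¹' B) = volume B := measure_preimage_add _ _ _
  rw [← hC, ← h1, ← h2, ← measure_union₀]
  · refine measure_mono ?_
    rintro x (hx | hx)
    · have := h _ hx b hbB
      simp only [Set.mem_preimage]
      convert this using 1
      ring
    · have := h a haA _ hx
      simp only [Set.mem_preimage]
      convert this using 1
      ring
  · exact (hB.measurableSet.preimage (measurable_const_add _)).nullMeasurableSet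
  · refine measure_mono_null (t := {a + b}) ?_ (by simp)
    rintro x ⟨hx, hx'⟩
    have h3 := ha hx
    have h4 := hb hx'
    simp only [Set.mem_singleton_iff]
    linarith

/-- One-dimensional Brunn–Minkowski inequality for midpoints. -/
theorem volume_add_volume_le_of_midpoint {A B C : Set ℝ} (hA : MeasurableSet A)
    (hB : MeasurableSet B) (hA0 : A.Nonempty) (hB0 : B.Nonempty)
    (h : ∀ x ∈ A, ∀ y ∈ B, (x + y) / 2 ∈ C) :
    volume A + volume B ≤ 2 * volume C := by
  obtain ⟨a, ha⟩ := hA0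
  obtain ⟨b, hb⟩ := hB0
  have inner : ∀ S : Set ℝ, MeasurableSet S →
      volume S = ⨆ K, ⨆ _ : K ⊆ S ∧ IsCompact K, volume K := fun S hS => by
    simp only [hS.measure_eq_iSup_isCompact, iSup_and]
  rw [inner A hA, inner B hB]
  refine ENNReal.biSup_add_biSup_le' ⟨∅, by simp⟩ ⟨∅, by simp⟩ fun K hK K' hK' => ?_
  calc volume K + volume K' ≤ volume (K ∪ {a}) + volume (K' ∪ {b}) := by
        gcongr <;> exact Set.subset_union_left
    _ ≤ 2 * volume C := by
        refine volume_add_volume_le_of_isCompact (hK.2.union isCompact_singleton)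
          (hK'.2.union isCompact_singleton) (by simp) (by simp) fun x hx y hy => h x ?_ y ?_
        · exact Set.union_subset hK.1 (by simpa using ha) hx
        · exact Set.union_subset hK'.1 (by simpa using hb) hy

/-- Prékopa–Leindler in dimension one, for functions with supremum `1`. -/
theorem lintegral_add_lintegral_le_of_min_le {f g h : ℝ → ℝ} (hf : Measurable f)
    (hg : Measurable g) (hh : Measurable h) (hf0 : 0 ≤ f) (hg0 : 0 ≤ g) (hh0 : 0 ≤ h)
    (hf1 : f ≤ 1) (hg1 : g ≤ 1) (hfs : ∀ t < 1, ∃ x, t < f x) (hgs : ∀ t < 1, ∃ x, t < g x)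
    (H : ∀ x y, min (f x) (g y) ≤ h ((x + y) / 2)) :
    (∫⁻ x, ENNReal.ofReal (f x)) + (∫⁻ x, ENNReal.ofReal (g x))
      ≤ 2 * ∫⁻ x, ENNReal.ofReal (h x) := by
  rw [lintegral_eq_lintegral_meas_lt _ (.of_forall hf0) hf.aemeasurable,
    lintegral_eq_lintegral_meas_lt _ (.of_forall hg0) hg.aemeasurable,
    lintegral_eq_lintegral_meas_lt _ (.of_forall hh0) hh.aemeasurable,
    ← lintegral_const_mul' _ _ (by simp), ← lintegral_add_left]
  · refine lintegral_mono fun t => ?_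
    by_cases ht : t < 1
    · refine volume_add_volume_le_of_midpoint (hf measurableSet_Ioi) (hg measurableSet_Ioi)
        (hfs t ht) (hgs t ht) fun x hx y hy => lt_of_lt_of_le (lt_min hx hy) (H x y)
    · have e1 : {x | t < f x} = ∅ := by
        ext x; simpa using (hf1 x).trans (not_lt.1 ht)
      have e2 : {x | t < g x} = ∅ := by
        ext x; simpa using (hg1 x).trans (not_lt.1 ht)
      simp [e1, e2]
  · exact Antitone.measurable fun s t hst => measure_mono fun x hx => lt_of_le_of_lt hst hx

/-- The Prékopa–Leindler inequality on the line, for bounded functions. -/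
theorem prekopa_leindler_real_of_bdd {f g h : ℝ → ENNReal} (hf : Measurable f)
    (hg : Measurable g) (hh : Measurable h) {K K' : ENNReal} (hK : K ≠ ⊤) (hK' : K' ≠ ⊤)
    (hfK : ∀ x, f x ≤ K) (hgK : ∀ x, g x ≤ K')
    (H : ∀ x y, f x * g y ≤ h ((x + y) / 2) ^ 2) :
    (∫⁻ x, f x) * (∫⁻ x, g x) ≤ (∫⁻ x, h x) ^ 2 := by
  set M := ⨆ x, f x with hM
  set N := ⨆ x, g x with hN
  have hfM : ∀ x, f x ≤ M := le_iSup f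
  have hgN : ∀ x, g x ≤ N := le_iSup g
  have hMt : M ≠ ⊤ := ((iSup_le hfK).trans_lt hK.lt_top).ne
  have hNt : N ≠ ⊤ := ((iSup_le hgK).trans_lt hK'.lt_top).ne
  rcases eq_or_ne M 0 with h0 | hM0
  · have : ∀ x, f x = 0 := fun x => by simpa [h0] using hfM x
    simp [this]
  rcases eq_or_ne N 0 with h0 | hN0
  · have : ∀ x, g x = 0 := fun x => by simpa [h0] using hgN x
    simp [this]
  lift M to NNReal using hMt with m hm
  lift N to NNReal using hNt with n hn
  have hft : ∀ x, f x ≠ ⊤ := fun x => ((hfM x).trans_lt ENNReal.coe_lt_top).ne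
  have hgt : ∀ x, g x ≠ ⊤ := fun x => ((hgN x).trans_lt ENNReal.coe_lt_top).ne
  have hm0 : (0 : ℝ) < m := by
    have : m ≠ 0 := by simpa using hM0
    positivity
  have hn0 : (0 : ℝ) < n := by
    have : n ≠ 0 := by simpa using hN0
    positivity
  set c : ℝ := √(m * n) with hc
  have hc2 : c ^ 2 = m * n := Real.sq_sqrt (by positivity)
  have hc0 : 0 < c := Real.sqrt_pos.2 (by positivity)
  have hmt : ∀ x, min (h x) (ENNReal.ofReal c) ≠ ⊤ := fun x =>
    ((min_le_right _ _).trans_lt ENNReal.ofReal_lt_top).ne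
  have scale : ∀ (u : ℝ → ENNReal) (r : ℝ), 0 < r → (∀ x, u x ≠ ⊤) →
      ∫⁻ x, ENNReal.ofReal ((u x).toReal / r) = (∫⁻ x, u x) / ENNReal.ofReal r := by
    intro u r hr hu
    simp_rw [ENNReal.ofReal_div_of_pos hr, ENNReal.ofReal_toReal (hu _), div_eq_mul_inv]
    rw [lintegral_mul_const' _ _ (by simpa using hr)]
  have lt_real : ∀ (a : ℝ) (b : ENNReal), b ≠ ⊤ → ENNReal.ofReal a < b → a < b.toReal := by
    intro a b hb hab
    by_contra! hba
    rw [← ENNReal.ofReal_toReal hb] at hab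
    exact absurd (ENNReal.ofReal_le_ofReal hba) hab.not_ge
  have hf1 : ∀ x, (f x).toReal / m ≤ 1 := fun x => by
    simpa [div_le_one hm0] using ENNReal.toReal_mono ENNReal.coe_ne_top (hfM x)
  have hg1 : ∀ x, (g x).toReal / n ≤ 1 := fun x => by
    simpa [div_le_one hn0] using ENNReal.toReal_mono ENNReal.coe_ne_top (hgN x)
  have key := lintegral_add_lintegral_le_of_min_le (f := fun x => (f x).toReal / m)
    (g := fun x => (g x).toReal / n)
    (h := fun x => (min (h x) (ENNReal.ofReal c)).toReal / c)
    (hf.ennreal_toReal.div_const _) (hg.ennreal_toReal.div_const _)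
    ((hh.min measurable_const).ennreal_toReal.div_const _)
    (fun x => by positivity) (fun x => by positivity) (fun x => by positivity)
    hf1 hg1
    (fun t ht => by
      have h1 : ENNReal.ofReal (t * m) < ⨆ x, f x := by
        rw [← hM, ← ENNReal.ofReal_coe_nnreal, ENNReal.ofReal_lt_ofReal_iff hm0]
        nlinarith
      obtain ⟨x, hx⟩ := lt_iSup_iff.1 h1
      exact ⟨x, by rw [lt_div_iff₀ hm0]; exact lt_real _ _ (hft x) hx⟩)
    (fun t ht => by
      have h1 : ENNReal.ofReal (t * n) < ⨆ x, g x := by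
        rw [← hN, ← ENNReal.ofReal_coe_nnreal, ENNReal.ofReal_lt_ofReal_iff hn0]
        nlinarith
      obtain ⟨x, hx⟩ := lt_iSup_iff.1 h1
      exact ⟨x, by rw [lt_div_iff₀ hn0]; exact lt_real _ _ (hgt x) hx⟩)
    (fun x y => by
      rcases le_total (ENNReal.ofReal c) (h ((x + y) / 2)) with hle | hle
      · simpa [min_eq_right hle, ENNReal.toReal_ofReal hc0.le, hc0.ne'] using Or.inl (hf1 x)
      · simp only [min_eq_left hle]
        have hxy := ENNReal.toReal_mono
          (ENNReal.pow_ne_top (hle.trans_lt ENNReal.ofReal_lt_top).ne) (H x y)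
        rw [ENNReal.toReal_mul, ENNReal.toReal_pow] at hxy
        have h1 : (f x).toReal / m * ((g y).toReal / n)
            ≤ ((h ((x + y) / 2)).toReal / c) ^ 2 := by
          rw [div_pow, hc2, div_mul_div_comm]
          gcongr
        refine abs_le_of_sq_le_sq' (h1.trans' ?_) (by positivity) |>.2
        rw [sq]
        gcongr
        · exact min_le_left _ _
        · exact min_le_right _ _)
  rw [scale f m hm0 hft, scale g n hn0 hgt, scale _ c hc0 hmt] at key
  have key2 : (∫⁻ x, f x) / ENNReal.ofReal m + (∫⁻ x, g x) / ENNReal.ofReal n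
      ≤ 2 * ((∫⁻ x, h x) / ENNReal.ofReal c) := by
    refine key.trans ?_
    gcongr
    exact min_le_left _ _
  clear key
  generalize (∫⁻ x, f x) = I at key2 ⊢
  generalize (∫⁻ x, g x) = J at key2 ⊢
  generalize (∫⁻ x, h x) = T at key2 ⊢
  rcases eq_or_ne T ⊤ with rfl | hT
  · simp
  have hfin : 2 * (T / ENNReal.ofReal c) ≠ ⊤ :=
    ENNReal.mul_ne_top (by simp) (ENNReal.div_ne_top hT (by simpa using hc0))
  have hI : I ≠ ⊤ := by
    rintro rfl
    refine hfin (top_le_iff.1 (key2.trans' ?_))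
    simp [ENNReal.top_div]
  have hJ : J ≠ ⊤ := by
    rintro rfl
    refine hfin (top_le_iff.1 (key2.trans' ?_))
    simp [ENNReal.top_div]
  lift I to NNReal using hI
  lift J to NNReal using hJ
  lift T to NNReal using hT
  have key3 : (I : ℝ) / m + J / n ≤ 2 * (T / c) := by
    have := ENNReal.toReal_mono hfin key2
    rw [ENNReal.toReal_add (ENNReal.div_ne_top (by simp) (by simpa using hM0))
      (ENNReal.div_ne_top (by simp) (by simpa using hN0))] at this
    simpa [ENNReal.toReal_ofReal hc0.le] using this
  have : (I : ℝ) * J ≤ T ^ 2 := by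
    have h1 : (I : ℝ) / m * (J / n) ≤ (T / c) ^ 2 := by
      have : 0 ≤ (I : ℝ) / m + J / n := by positivity
      nlinarith [sq_nonneg ((I : ℝ) / m - J / n)]
    rw [div_pow, hc2, div_mul_div_comm] at h1
    exact (div_le_div_iff_of_pos_right (by positivity)).1 h1
  exact_mod_cast this

/-- The **Prékopa–Leindler inequality** on the line, with weights `1/2`. -/
theorem prekopa_leindler_real {f g h : ℝ → ENNReal} (hf : Measurable f)
    (hg : Measurable g) (hh : Measurable h)
    (H : ∀ x y, f x * g y ≤ h ((x + y) / 2) ^ 2) :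
    (∫⁻ x, f x) * (∫⁻ x, g x) ≤ (∫⁻ x, h x) ^ 2 := by
  have trunc : ∀ u : ℝ → ENNReal, Measurable u →
      ∫⁻ x, u x = ⨆ k : ℕ, ∫⁻ x, min (u x) k := by
    intro u hu
    rw [← lintegral_iSup (fun k => hu.min measurable_const)]
    · refine lintegral_congr fun x => ?_
      rw [← inf_iSup_eq, ENNReal.iSup_natCast, inf_top_eq]
    · intro i j hij x
      dsimp only
      gcongr
  rw [trunc f hf, trunc g hg]
  simp_rw [ENNReal.iSup_mul, ENNReal.mul_iSup]
  refine iSup₂_le fun i j => ?_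
  exact prekopa_leindler_real_of_bdd (hf.min measurable_const) (hg.min measurable_const) hh
    (ENNReal.natCast_ne_top i) (ENNReal.natCast_ne_top j) (fun x => min_le_right _ _)
    (fun x => min_le_right _ _)
    fun x y => le_trans (mul_le_mul' (min_le_left _ _) (min_le_left _ _)) (H x y)

/-- The **Prékopa–Leindler inequality** on `Fin n → ℝ`, with weights `1/2`. -/
theorem prekopa_leindler_pi (n : ℕ) {f g h : (Fin n → ℝ) → ENNReal} (hf : Measurable f)
    (hg : Measurable g) (hh : Measurable h)
    (H : ∀ x y, f x * g y ≤ h ((2⁻¹ : ℝ) • (x + y)) ^ 2) :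
    (∫⁻ x, f x) * (∫⁻ x, g x) ≤ (∫⁻ x, h x) ^ 2 := by
  induction n with
  | zero =>
    simpa [MeasureTheory.volume_pi, Measure.pi_of_empty _ (0 : Fin 0 → ℝ)] using H 0 0
  | succ n ih =>
    set e := (MeasurableEquiv.piFinSuccAbove (fun _ : Fin (n + 1) => ℝ) 0).symm with he
    have hep : MeasurePreserving e := (volume_preserving_piFinSuccAbove (fun _ => ℝ) 0).symm _
    have split : ∀ u : (Fin (n + 1) → ℝ) → ENNReal, Measurable u →
        ∫⁻ x, u x = ∫⁻ s : ℝ, ∫⁻ v : Fin n → ℝ, u (e (s, v)) := by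
      intro u hu
      rw [← hep.lintegral_comp hu, Measure.volume_eq_prod,
        lintegral_prod (fun z => u (e z)) (hu.comp e.measurable).aemeasurable]
    rw [split f hf, split g hg, split h hh]
    refine prekopa_leindler_real (hf.comp e.measurable).lintegral_prod_right'
      (hg.comp e.measurable).lintegral_prod_right'
      (hh.comp e.measurable).lintegral_prod_right' fun s t => ?_
    have hs : ∀ s : ℝ, Measurable fun v : Fin n → ℝ => e (s, v) := fun s =>
      e.measurable.comp measurable_prodMk_left
    refine ih (hf.comp (hs _)) (hg.comp (hs _)) (hh.comp (hs _)) fun v w => ?_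
    refine (H _ _).trans_eq ?_
    congr 2
    ext i
    refine Fin.cases ?_ (fun j => ?_) i
    · simp [he, MeasurableEquiv.piFinSuccAbove]
      ring
    · simp [he, MeasurableEquiv.piFinSuccAbove]
      ring

/-- The **Prékopa–Leindler inequality** on Euclidean space, with weights `1/2`. -/
theorem prekopa_leindler {n : ℕ} {f g h : EuclideanSpace ℝ (Fin n) → ENNReal} (hf : Measurable f)
    (hg : Measurable g) (hh : Measurable h)
    (H : ∀ x y, f x * g y ≤ h ((2⁻¹ : ℝ) • (x + y)) ^ 2) :
    (∫⁻ x, f x) * (∫⁻ x, g x) ≤ (∫⁻ x, h x) ^ 2 := by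
  have hp := PiLp.volume_preserving_toLp (Fin n)
  rw [← hp.lintegral_comp hf, ← hp.lintegral_comp hg, ← hp.lintegral_comp hh]
  refine prekopa_leindler_pi n (hf.comp hp.measurable) (hg.comp hp.measurable)
    (hh.comp hp.measurable) fun v w => ?_
  simpa using H (WithLp.toLp 2 v) (WithLp.toLp 2 w)

/-- Bound on the product of the Laplace transforms of `F` and `-F` under a strongly log-concave density
on an open convex set. -/
theorem lintegral_exp_mul_lintegral_exp_neg_le {n : ℕ} {U : Set (EuclideanSpace ℝ (Fin n))}
    (hU : IsOpen U) {F V : EuclideanSpace ℝ (Fin n) → ℝ} {L γ : ℝ} (hγ : 0 < γ)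
    (hLip : ∀ x ∈ U, ∀ y ∈ U, |F x - F y| ≤ L * ‖x - y‖)
    (hFc : ContinuousOn F U) (hVc : ContinuousOn V U) (hV : StrongConvexOn U γ V) :
    (∫⁻ x in U, ENNReal.ofReal (Real.exp (F x - V x))) *
      (∫⁻ x in U, ENNReal.ofReal (Real.exp (-F x - V x))) ≤
    (ENNReal.ofReal (Real.exp (L ^ 2 / (2 * γ))) *
      ∫⁻ x in U, ENNReal.ofReal (Real.exp (-V x))) ^ 2 := by
  have meas : ∀ G : EuclideanSpace ℝ (Fin n) → ℝ, ContinuousOn G U →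
      Measurable (U.indicator fun x => ENNReal.ofReal (Real.exp (G x))) := by
    intro G hG
    classical
    rw [← Set.piecewise_eq_indicator]
    exact ContinuousOn.measurable_piecewise
      (ENNReal.continuous_ofReal.comp_continuousOn (Real.continuous_exp.comp_continuousOn hG))
      continuousOn_const hU.measurableSet
  have hconst : ENNReal.ofReal (Real.exp (L ^ 2 / (2 * γ))) *
      (∫⁻ x in U, ENNReal.ofReal (Real.exp (-V x))) =
      ∫⁻ x in U, ENNReal.ofReal (Real.exp (L ^ 2 / (2 * γ) - V x)) := by
    rw [← lintegral_const_mul' _ _ ENNReal.ofReal_ne_top]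
    refine lintegral_congr fun x => ?_
    rw [← ENNReal.ofReal_mul (Real.exp_nonneg _), ← Real.exp_add, sub_eq_add_neg]
  rw [hconst, ← lintegral_indicator hU.measurableSet, ← lintegral_indicator hU.measurableSet,
    ← lintegral_indicator hU.measurableSet]
  refine prekopa_leindler (meas _ (hFc.sub hVc)) (meas _ (hFc.neg.sub hVc))
    (meas _ (continuousOn_const.sub hVc)) fun x y => ?_
  by_cases hx : x ∈ U
  swap
  · simp [hx]
  by_cases hy : y ∈ U
  swap
  · simp [hy]
  have hxy : (2⁻¹ : ℝ) • (x + y) ∈ U := by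
    rw [smul_add]
    exact hV.1 hx hy (by norm_num) (by norm_num) (by norm_num)
  have hmid := hV.2 hx hy (by norm_num : (0 : ℝ) ≤ 2⁻¹) (by norm_num : (0 : ℝ) ≤ 2⁻¹)
    (by norm_num)
  rw [← smul_add] at hmid
  simp only [smul_eq_mul] at hmid
  rw [Set.indicator_of_mem hx, Set.indicator_of_mem hy, Set.indicator_of_mem hxy,
    ← ENNReal.ofReal_mul (Real.exp_nonneg _), ← ENNReal.ofReal_pow (Real.exp_nonneg _),
    ← Real.exp_add, ← Real.exp_nat_mul]
  refine ENNReal.ofReal_le_ofReal (Real.exp_le_exp.2 ?_)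
  have hF := (le_abs_self _).trans (hLip x hx y hy)
  have hquad : L * ‖x - y‖ - γ / 4 * ‖x - y‖ ^ 2 ≤ 2 * (L ^ 2 / (2 * γ)) := by
    have : 2 * (L ^ 2 / (2 * γ)) - (L * ‖x - y‖ - γ / 4 * ‖x - y‖ ^ 2)
        = (L - γ / 2 * ‖x - y‖) ^ 2 / γ := by
      field_simp
      ring
    have : 0 ≤ (L - γ / 2 * ‖x - y‖) ^ 2 / γ := by positivity
    linarith
  push_cast
  linarith

/-- Gaussian bound on the Laplace transform of a centred random variable, from a bound on the
product of the Laplace transforms of the variable and of its opposite. -/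
theorem lintegral_exp_le_of_mul_le {Ω : Type*} [MeasurableSpace Ω] {ν : Measure Ω}
    [IsProbabilityMeasure ν] {G : Ω → ℝ} (hG : Integrable G ν) (hG0 : ∫ x, G x ∂ν = 0)
    {C : ENNReal}
    (h : (∫⁻ x, ENNReal.ofReal (Real.exp (G x)) ∂ν) *
      (∫⁻ x, ENNReal.ofReal (Real.exp (-G x)) ∂ν) ≤ C) :
    ∫⁻ x, ENNReal.ofReal (Real.exp (G x)) ∂ν ≤ C := by
  have h1 : 1 ≤ ∫⁻ x, ENNReal.ofReal (Real.exp (-G x)) ∂ν := by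
    have hint : Integrable (fun x => -G x + 1) ν := hG.neg.add (integrable_const 1)
    have e : ∫ x, (-G x + 1) ∂ν = 1 := by
      rw [integral_add (f := fun x => -G x) hG.neg (integrable_const 1), integral_neg, hG0]
      simp
    calc (1 : ENNReal) = ENNReal.ofReal (∫ x, (-G x + 1) ∂ν) := by simp [e]
      _ ≤ ∫⁻ x, ENNReal.ofReal (-G x + 1) ∂ν := by
        rw [integral_eq_lintegral_pos_part_sub_lintegral_neg_part hint]
        refine ENNReal.ofReal_le_of_le_toReal (sub_le_self _ ENNReal.toReal_nonneg)
      _ ≤ _ := lintegral_mono fun x => ENNReal.ofReal_le_ofReal (Real.add_one_le_exp _)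
  exact (le_mul_of_one_le_right' h1).trans h

/-- Chernoff bound for one tail of a Lipschitz function of a strongly log-concave vector. -/
theorem measure_lt_sub_integral_le {n : ℕ} {U : Set (EuclideanSpace ℝ (Fin n))}
    (hU : IsOpen U) {F V : EuclideanSpace ℝ (Fin n) → ℝ} {L γ : ℝ} (hL : 0 < L) (hγ : 0 < γ)
    (hLip : ∀ x ∈ U, ∀ y ∈ U, |F x - F y| ≤ L * ‖x - y‖)
    (hFc : ContinuousOn F U) (hVc : ContinuousOn V U) (hV : StrongConvexOn U γ V)
    {ν : Measure (EuclideanSpace ℝ (Fin n))} [IsProbabilityMeasure ν]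
    (hν : ν = (volume.restrict U).withDensity fun x => ENNReal.ofReal (Real.exp (-V x)))
    (hF : Integrable F ν) {ε : ℝ} (hε : 0 < ε) :
    ν {x | ε < F x - ∫ y, F y ∂ν} ≤ ENNReal.ofReal (Real.exp (-γ * ε ^ 2 / (4 * L ^ 2))) := by
  set m := ∫ y, F y ∂ν with hm
  set t : ℝ := γ * ε / (2 * L ^ 2) with ht
  have ht0 : 0 < t := by positivity
  have hdens : AEMeasurable (fun x => ENNReal.ofReal (Real.exp (-V x))) (volume.restrict U) :=
    (ENNReal.continuous_ofReal.comp_continuousOn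
      (Real.continuous_exp.comp_continuousOn hVc.neg)).aemeasurable hU.measurableSet
  have hlin : ∀ G : EuclideanSpace ℝ (Fin n) → ℝ, ∫⁻ x, ENNReal.ofReal (Real.exp (G x)) ∂ν
      = ∫⁻ x in U, ENNReal.ofReal (Real.exp (G x - V x)) := by
    intro G
    rw [hν, lintegral_withDensity_eq_lintegral_mul_non_measurable₀ _ hdens
      (.of_forall fun x => ENNReal.ofReal_lt_top)]
    refine lintegral_congr fun x => ?_
    rw [Pi.mul_apply, ← ENNReal.ofReal_mul (Real.exp_nonneg _), ← Real.exp_add,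
      neg_add_eq_sub]
  have hmass : ∫⁻ x in U, ENNReal.ofReal (Real.exp (-V x)) = 1 := by
    simpa using (hlin fun _ => 0).symm
  have hGint : Integrable (fun x => t * (F x - m)) ν := (hF.sub (integrable_const m)).const_mul t
  have hG0 : ∫ x, t * (F x - m) ∂ν = 0 := by
    rw [integral_const_mul, integral_sub hF (integrable_const m)]
    simp [hm]
  have hlap : ∫⁻ x, ENNReal.ofReal (Real.exp (t * (F x - m))) ∂ν
      ≤ ENNReal.ofReal (Real.exp ((t * L) ^ 2 / γ)) := by
    refine lintegral_exp_le_of_mul_le hGint hG0 ?_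
    rw [hlin, hlin]
    refine (lintegral_exp_mul_lintegral_exp_neg_le hU (F := fun x => t * (F x - m))
      (L := t * L) hγ ?_
      (continuousOn_const.mul (hFc.sub continuousOn_const)) hVc hV).trans_eq ?_
    · intro x hx y hy
      rw [← mul_sub, sub_sub_sub_cancel_right, abs_mul, abs_of_pos ht0, mul_assoc]
      exact mul_le_mul_of_nonneg_left (hLip x hx y hy) ht0.le
    · rw [hmass, mul_one, ← ENNReal.ofReal_pow (Real.exp_nonneg _), ← Real.exp_nat_mul]
      congr 2
      push_cast
      field_simp
  have hmarkov := meas_ge_le_lintegral_div (μ := ν)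
    (f := fun x => ENNReal.ofReal (Real.exp (t * (F x - m))))
    (hGint.aemeasurable.exp.ennreal_ofReal) (ε := ENNReal.ofReal (Real.exp (t * ε)))
    (by simpa using Real.exp_pos _) ENNReal.ofReal_ne_top
  calc ν {x | ε < F x - m}
      ≤ ν {x | ENNReal.ofReal (Real.exp (t * ε)) ≤ ENNReal.ofReal (Real.exp (t * (F x - m)))} := by
        refine measure_mono fun x hx => ?_
        exact ENNReal.ofReal_le_ofReal (Real.exp_le_exp.2
          (mul_le_mul_of_nonneg_left (le_of_lt hx) ht0.le))
    _ ≤ _ := hmarkov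
    _ ≤ ENNReal.ofReal (Real.exp ((t * L) ^ 2 / γ)) / ENNReal.ofReal (Real.exp (t * ε)) := by
        gcongr
    _ = ENNReal.ofReal (Real.exp (-γ * ε ^ 2 / (4 * L ^ 2))) := by
        rw [← ENNReal.ofReal_div_of_pos (Real.exp_pos _), ← Real.exp_sub]
        congr 2
        rw [ht]
        field_simp
        ring

theorem stmt_12 {n : ℕ} (A : Set (EuclideanSpace ℝ (Fin n))) (hA : Convex ℝ A)
    (hAmeas : MeasurableSet A)
    (F : EuclideanSpace ℝ (Fin n) → ℝ) (L γ : ℝ) (hL : 0 < L) (hγ : 0 < γ)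
    (hLip : ∀ x ∈ A, ∀ y ∈ A, |F x - F y| ≤ L * ‖x - y‖)
    (μ : Measure (EuclideanSpace ℝ (Fin n))) [IsProbabilityMeasure μ]
    (V : EuclideanSpace ℝ (Fin n) → ℝ)
    (hdens : μ[|A] = (volume.restrict A).withDensity fun x => ENNReal.ofReal (Real.exp (-V x)))
    (hstrong : StrongConvexOn A γ V)
    (hFint : Integrable F (μ[|A])) :
    ∀ ε > 0, (μ[|A]) {x | ε < |F x - ∫ y, F y ∂(μ[|A])|}
      ≤ ENNReal.ofReal (2 * Real.exp (-γ * ε ^ 2 / (4 * L ^ 2))) := by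
  intro ε hε
  by_cases hμA : μ A = 0
  · simp [cond_eq_zero_of_meas_eq_zero hμA]
  have : IsProbabilityMeasure (μ[|A]) := cond_isProbabilityMeasure hμA
  have hsub : interior A ⊆ A := interior_subset
  have hres : volume.restrict (interior A) = volume.restrict A :=
    Measure.restrict_congr_set (interior_ae_eq_of_null_frontier (hA.addHaar_frontier volume))
  rw [← hres] at hdens
  have hVc : ContinuousOn V (interior A) :=
    (hstrong.convexOn fun r => by positivity).continuousOn_interior
  have hV : StrongConvexOn (interior A) γ V :=
    ⟨hA.interior, fun x hx y hy => hstrong.2 (hsub hx) (hsub hy)⟩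
  have hLip' : ∀ x ∈ interior A, ∀ y ∈ interior A, |F x - F y| ≤ L * ‖x - y‖ :=
    fun x hx y hy => hLip x (hsub hx) y (hsub hy)
  have hFc : ContinuousOn F (interior A) :=
    (LipschitzOnWith.of_dist_le_mul (K := L.toNNReal) fun x hx y hy => by
      simpa [Real.dist_eq, dist_eq_norm, hL.le] using hLip' x hx y hy).continuousOn
  have upper := measure_lt_sub_integral_le isOpen_interior hL hγ hLip' hFc hVc hV hdens hFint hε
  have lower := measure_lt_sub_integral_le isOpen_interior (F := fun x => -F x) hL hγ
    (fun x hx y hy => by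
      rw [← abs_neg]; simpa [neg_add_eq_sub, abs_sub_comm] using hLip' x hx y hy)
    hFc.neg hVc hV hdens hFint.neg hε
  rw [integral_neg] at lower
  rw [two_mul, ENNReal.ofReal_add (Real.exp_nonneg _) (Real.exp_nonneg _)]
  refine (measure_mono fun x hx => ?_).trans ((measure_union_le _ _).trans (add_le_add upper lower))
  have hx' : ε < |F x - ∫ y, F y ∂(μ[|A])| := hx
  rcases lt_abs.1 hx' with h | h
  · exact Or.inl h
  · refine Or.inr ?_
    simp only [Set.mem_ofPred_eq]
    linarith
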